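/- Let a > 0, b_1, b_2 > 0 and a_1 ∈ ℝ, and define s(u) = a_1/(u² + b_1²) − a_1/(u² + b_2²) for u ∈ ℝ. Then for every ω ∈ ℝ, (1/a) Σ_{k ∈ ℤ} s( (ω + 2πk)/a ) = (a_1/2) · [ sinh(a b_1) / ( b_1 (cosh(a b_1) − cos ω) ) − sinh(a b_2) / ( b_2 (cosh(a b_2) − cos ω) ) ]. -/

import Mathlib

open Real

open Complex in
/-- Differences of two simple fractions with poles at `-k` are summable over `k : ℤ`. -/
lemma summable_one_div_add_int_sub {z w : ℂ} (hz : z ∈ integerComplement)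
    (hw : w ∈ integerComplement) :
    Summable fun k : ℤ ↦ 1 / (w + k) - 1 / (z + k) := by
  have hO := (EisensteinSeries.linear_inv_isBigO_right 1 w).mul
    (EisensteinSeries.linear_inv_isBigO_right 1 z)
  have hS : Summable fun k : ℤ ↦ (w + k)⁻¹ * (z + k)⁻¹ := by
    refine summable_of_isBigO ((Real.summable_abs_int_rpow one_lt_two)) ?_
    refine (hO.congr (fun k ↦ by simp) (fun k ↦ ?_))
    rw [Real.rpow_neg (abs_nonneg _), Real.rpow_two, sq_abs, sq, mul_inv]
  refine (hS.mul_left (z - w)).congr fun k ↦ ?_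
  have h₁ := integerComplement_add_ne_zero hz k
  have h₂ := integerComplement_add_ne_zero hw k
  field_simp
  ring

open Complex in
/-- The Mittag-Leffler expansion of a difference of two cotangents, summed over `ℤ`. -/
lemma hasSum_one_div_add_int_sub {z w : ℂ} (hz : z ∈ integerComplement)
    (hw : w ∈ integerComplement) :
    HasSum (fun k : ℤ ↦ 1 / (w + k) - 1 / (z + k)) (π * cot (π * w) - π * cot (π * z)) := by
  set f : ℤ → ℂ := fun k ↦ 1 / (w + k) - 1 / (z + k) with hf
  have hS : Summable f := summable_one_div_add_int_sub hz hw
  have hcot := (summable_cotTerm hw).tsum_sub (summable_cotTerm hz)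
  simp only [cotTerm] at hcot
  rw [← cot_series_rep' hz, ← cot_series_rep' hw] at hcot
  have hpos : Summable fun n : ℕ ↦ f (n + 1) :=
    hS.comp_injective (i := fun n : ℕ ↦ (n : ℤ) + 1) fun m n h ↦ by simpa using h
  have hneg : Summable fun n : ℕ ↦ f (-(n + 1)) :=
    hS.comp_injective (i := fun n : ℕ ↦ -((n : ℤ) + 1)) fun m n h ↦ by
      simp only at h
      lia
  have htsum := tsum_of_add_one_of_neg_add_one hpos hneg
  rw [add_right_comm, ← hpos.tsum_add hneg] at htsum
  have hpair : ∀ n : ℕ, f (n + 1) + f (-(n + 1)) =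
      1 / (w - (n + 1)) + 1 / (w + (n + 1)) - (1 / (z - (n + 1)) + 1 / (z + (n + 1))) :=
    fun n ↦ by
      simp only [hf]
      push_cast
      rw [sub_eq_add_neg w (n + 1), sub_eq_add_neg z (n + 1)]
      ring
  rw [tsum_congr hpair, hcot] at htsum
  have hval : ∑' k, f k = π * cot (π * w) - π * cot (π * z) := by
    rw [htsum]
    simp only [hf, Int.cast_zero, add_zero]
    ring
  exact hval ▸ hS.hasSum

open Complex in
lemma cot_sub_cot {x y : ℂ} (hx : sin x ≠ 0) (hy : sin y ≠ 0) :
    cot x - cot y = 2 * sin (y - x) / (cos (y - x) - cos (y + x)) := by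
  have h : cos (y - x) - cos (y + x) = 2 * (sin x * sin y) := by
    rw [Complex.cos_sub, Complex.cos_add]; ring
  rw [h, Complex.sin_sub, Complex.cot, Complex.cot]
  field_simp

open Complex in
lemma mem_integerComplement_of_im_ne_zero {z : ℂ} (hz : z.im ≠ 0) : z ∈ integerComplement := by
  rintro ⟨k, rfl⟩
  simp at hz

/-- The periodization of the Cauchy density. -/
lemma hasSum_one_div_add_two_pi_mul_int_sq_add_sq {c : ℝ} (hc : 0 < c) (ω : ℝ) :
    HasSum (fun k : ℤ ↦ 1 / ((ω + 2 * π * k) ^ 2 + c ^ 2))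
      (sinh c / (2 * c * (cosh c - cos ω))) := by
  have hπ : (π : ℂ) ≠ 0 := by exact_mod_cast pi_ne_zero
  have hcC : (c : ℂ) ≠ 0 := by exact_mod_cast hc.ne'
  set z : ℂ := (ω + c * Complex.I) / (2 * π) with hz
  set w : ℂ := (ω - c * Complex.I) / (2 * π) with hw
  have him : c / (2 * π) ≠ 0 := by positivity
  have hz_eq : z = ((ω / (2 * π) : ℝ) : ℂ) + ((c / (2 * π) : ℝ) : ℂ) * Complex.I := by
    rw [hz]; push_cast; ring
  have hw_eq : w = ((ω / (2 * π) : ℝ) : ℂ) + ((-(c / (2 * π)) : ℝ) : ℂ) * Complex.I := by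
    rw [hw]; push_cast; ring
  have hzm : z ∈ Complex.integerComplement := mem_integerComplement_of_im_ne_zero <| by
    rw [hz_eq, Complex.add_im, Complex.ofReal_im, Complex.im_ofReal_mul, Complex.I_im]
    simpa using him
  have hwm : w ∈ Complex.integerComplement := mem_integerComplement_of_im_ne_zero <| by
    rw [hw_eq, Complex.add_im, Complex.ofReal_im, Complex.im_ofReal_mul, Complex.I_im]
    simpa using him
  have hsum := (hasSum_one_div_add_int_sub hzm hwm).mul_left (4 * π * c * Complex.I)⁻¹
  rw [← mul_sub, cot_sub_cot (sin_pi_mul_ne_zero hwm) (sin_pi_mul_ne_zero hzm),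
    show π * z - π * w = c * Complex.I by rw [hz, hw]; field_simp; ring,
    show π * z + π * w = ω by rw [hz, hw]; field_simp; ring,
    Complex.sin_mul_I, Complex.cos_mul_I] at hsum
  rw [← Complex.hasSum_ofReal]
  have hval : ((sinh c / (2 * c * (cosh c - cos ω)) : ℝ) : ℂ) =
      (4 * π * c * Complex.I)⁻¹ * (π * (2 * (Complex.sinh c * Complex.I) /
        (Complex.cosh c - Complex.cos ω))) := by
    have := Complex.I_ne_zero
    push_cast
    field_simp
    ring
  rw [hval]
  refine hsum.congr_fun fun k ↦ ?_
  have h₁ := Complex.integerComplement_add_ne_zero hzm k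
  have h₂ := Complex.integerComplement_add_ne_zero hwm k
  have hprod : ((ω : ℂ) + 2 * π * k) ^ 2 + c ^ 2 = 4 * π ^ 2 * ((w + k) * (z + k)) := by
    rw [hz, hw]
    field_simp
    linear_combination (4 * (c : ℂ) ^ 2) * Complex.I_sq
  have hdiff : 1 / (w + k) - 1 / (z + k) = c * Complex.I / π / ((w + k) * (z + k)) := by
    rw [show c * Complex.I / π = (z + k) - (w + k) by rw [hz, hw]; field_simp; ring]
    field_simp
  push_cast
  rw [hprod, hdiff]
  have := Complex.I_ne_zero
  field_simp

/-- Let `a > 0`, `b₁, b₂ > 0` and `a₁ ∈ ℝ`, and define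
`s(u) = a₁/(u² + b₁²) − a₁/(u² + b₂²)`.  Then for every `ω ∈ ℝ`,
`(1/a) Σ_{k ∈ ℤ} s((ω + 2πk)/a)
  = (a₁/2)·[sinh(ab₁)/(b₁(cosh(ab₁) − cos ω)) − sinh(ab₂)/(b₂(cosh(ab₂) − cos ω))]`. -/
theorem stmt_15 (a b₁ b₂ a₁ : ℝ) (ha : 0 < a) (hb₁ : 0 < b₁) (hb₂ : 0 < b₂) (ω : ℝ) :
    (1 / a) * ∑' k : ℤ,
        (a₁ / (((ω + 2 * Real.pi * k) / a) ^ 2 + b₁ ^ 2) -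
          a₁ / (((ω + 2 * Real.pi * k) / a) ^ 2 + b₂ ^ 2)) =
      (a₁ / 2) *
        (Real.sinh (a * b₁) / (b₁ * (Real.cosh (a * b₁) - Real.cos ω)) -
          Real.sinh (a * b₂) / (b₂ * (Real.cosh (a * b₂) - Real.cos ω))) := by
  have hscale : ∀ b : ℝ, 0 < b → HasSum
      (fun k : ℤ ↦ a₁ / (((ω + 2 * π * k) / a) ^ 2 + b ^ 2))
      (a₁ * a ^ 2 * (sinh (a * b) / (2 * (a * b) * (cosh (a * b) - cos ω)))) := fun b hb ↦ by
    refine ((hasSum_one_div_add_two_pi_mul_int_sq_add_sq (mul_pos ha hb) ω).mul_left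
      (a₁ * a ^ 2)).congr_fun fun k ↦ ?_
    have : 0 < (ω + 2 * π * k) ^ 2 + (a * b) ^ 2 := by positivity
    have : 0 < ((ω + 2 * π * k) / a) ^ 2 + b ^ 2 := by positivity
    field_simp
  rw [((hscale b₁ hb₁).sub (hscale b₂ hb₂)).tsum_eq]
  field_simp
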